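/- In any 2-crossed module of groups (L, E, G, δ, ∂, ▷, {,}), the 2-functoriality identity holds: for every X ∈ G, e, f ∈ E and k, l ∈ L, (e ▷′ {e⁻¹, X ▷ f}⁻¹) · ((X ▷ f) ▷′ k) · (X ▷ l) = (e ▷′ ((∂(e)⁻¹ X) ▷ l)) · (e ▷′ {e⁻¹ δ(k), X ▷ (δ(l)⁻¹ f)}⁻¹) · k. -/

import Mathlib

/-- A 2-crossed module of groups `(L, E, G, δ, ∂, ▷, {,})`.
`dl` is δ : L → E, `de` is ∂ : E → G, `actL`/`actE` are the left actions of `G`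
on `L` and `E` by group automorphisms, and `pl` is the Peiffer lifting. -/
structure TwoCrossedModule (L E G : Type*) [Group L] [Group E] [Group G] where
  /-- δ : L → E -/
  dl : L →* E
  /-- ∂ : E → G -/
  de : E →* G
  /-- the action of G on L by automorphisms -/
  actL : G →* MulAut L
  /-- the action of G on E by automorphisms -/
  actE : G →* MulAut E
  /-- the Peiffer lifting {,} : E × E → L -/
  pl : E → E → L
  comp_triv : ∀ l : L, de (dl l) = 1
  dl_equiv : ∀ (a : G) (l : L), dl (actL a l) = actE a (dl l)
  de_equiv : ∀ (a : G) (e : E), de (actE a e) = a * de e * a⁻¹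
  pl_equiv : ∀ (a : G) (e f : E), actL a (pl e f) = pl (actE a e) (actE a f)
  ax_i : ∀ e f : E, dl (pl e f) = e * f * e⁻¹ * actE (de e) f⁻¹
  ax_ii : ∀ l k : L, pl (dl l) (dl k) = l * k * l⁻¹ * k⁻¹
  ax_iii : ∀ e f g : E, pl (e * f) g = pl e (f * g * f⁻¹) * actL (de e) (pl f g)
  ax_iv : ∀ e f g : E, pl e (f * g) =
    pl e f * pl e g * pl (e * g * e⁻¹ * actE (de e) g⁻¹)⁻¹ (actE (de e) f)
  ax_v : ∀ (e : E) (l : L), pl (dl l) e * pl e (dl l) = l * actL (de e) l⁻¹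

/-- The operation `e ▷′ l := l * {δ(l)⁻¹, e}`. -/
def TwoCrossedModule.tprime {L E G : Type*} [Group L] [Group E] [Group G]
    (M : TwoCrossedModule L E G) (e : E) (l : L) : L :=
  l * M.pl (M.dl l)⁻¹ e

namespace TwoCrossedModule

variable {L E G : Type*} [Group L] [Group E] [Group G] (M : TwoCrossedModule L E G)

theorem pl_one_left (e : E) : M.pl 1 e = 1 := by
  simpa using M.ax_iii 1 1 e

theorem pl_one_right (e : E) : M.pl e 1 = 1 := by
  simpa [M.pl_one_left] using M.ax_iv e 1 1

theorem pl_dl_inv (l : L) (e : E) : M.pl (M.dl l)⁻¹ e = l⁻¹ * M.tprime e l := by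
  simp [tprime]

/-- The Peiffer lifting of a product in its second argument, in terms of `▷′`. -/
theorem pl_mul_right (e f g : E) :
    M.pl e (f * g) = M.pl e f * M.tprime (M.actE (M.de e) f) (M.pl e g) := by
  rw [M.ax_iv, ← M.ax_i, pl_dl_inv]
  group

theorem tprime_dl (l k : L) : M.tprime (M.dl l) k = l * k * l⁻¹ := by
  rw [tprime, ← map_inv, M.ax_ii]
  group

theorem de_dl_inv (l : L) : M.de (M.dl l)⁻¹ = 1 := by
  rw [map_inv, M.comp_triv, inv_one]

theorem dl_tprime (e : E) (l : L) : M.dl (M.tprime e l) = e * M.dl l * e⁻¹ := by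
  rw [tprime, map_mul, M.ax_i, de_dl_inv]
  simp [mul_assoc]

theorem tprime_one_right (e : E) : M.tprime e 1 = 1 := by
  simp [tprime, M.pl_one_left]

theorem tprime_one_left (l : L) : M.tprime 1 l = l := by
  simp [tprime, M.pl_one_right]

theorem tprime_mul_right (e : E) (l m : L) :
    M.tprime e (l * m) = M.tprime e l * M.tprime e m := by
  have hconj : (M.dl l)⁻¹ * e * (M.dl l)⁻¹⁻¹ = M.dl (M.pl (M.dl l)⁻¹ e) * e := by
    rw [M.ax_i, de_dl_inv]
    simp
  have h : M.pl (M.dl (l * m))⁻¹ e =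
      M.pl (M.dl m)⁻¹ (M.dl (M.pl (M.dl l)⁻¹ e) * e) * M.pl (M.dl l)⁻¹ e := by
    rw [map_mul, mul_inv_rev, M.ax_iii, hconj, de_dl_inv]
    simp
  rw [tprime, h, pl_mul_right, de_dl_inv, map_one, MulAut.one_apply, tprime_dl,
    pl_dl_inv M m (M.dl _), tprime_dl, tprime, tprime]
  group

theorem tprime_inv (e : E) (l : L) : M.tprime e l⁻¹ = (M.tprime e l)⁻¹ := by
  rw [eq_inv_iff_mul_eq_one, ← tprime_mul_right, inv_mul_cancel, tprime_one_right]

theorem tprime_mul_left (e f : E) (l : L) :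
    M.tprime (e * f) l = M.tprime e (M.tprime f l) := by
  rw [TwoCrossedModule.tprime.eq_def M f, tprime_mul_right, tprime, pl_mul_right, de_dl_inv, map_one,
    MulAut.one_apply, ← mul_assoc, ← tprime]

theorem tprime_tprime_inv (e : E) (l : L) : M.tprime e (M.tprime e⁻¹ l) = l := by
  rw [← tprime_mul_left, mul_inv_cancel, tprime_one_left]

theorem pl_dl (l : L) (e : E) : M.pl (M.dl l) e = l * (M.tprime e l)⁻¹ := by
  simpa [tprime_inv] using M.pl_dl_inv l⁻¹ e

theorem pl_dl_inv_right (e : E) (l : L) :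
    M.pl e (M.dl l)⁻¹ = (M.tprime e l)⁻¹ * M.actL (M.de e) l := by
  have h := M.ax_v e l⁻¹
  rw [map_inv, pl_dl_inv, inv_inv, mul_assoc, mul_left_cancel_iff] at h
  rw [← h, inv_mul_cancel_left]

/-- The value of `e ▷′ {e⁻¹, g}` when `e⁻¹` is multiplied by an element of the image of `δ`. -/
theorem tprime_pl_inv_mul_dl (e g : E) (k : L) :
    M.tprime e (M.pl (e⁻¹ * M.dl k) g) =
      k * (M.tprime g k)⁻¹ * M.tprime e (M.pl e⁻¹ g) := by
  have h : e⁻¹ * M.dl k = M.dl (M.tprime e⁻¹ k) * e⁻¹ := by simp [dl_tprime]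
  rw [h, M.ax_iii, M.comp_triv, map_one, MulAut.one_apply, pl_dl, ← tprime_mul_left,
    tprime_mul_right, tprime_mul_right, tprime_inv, tprime_tprime_inv, ← tprime_mul_left]
  congr 4
  group

/-- The value of `e ▷′ {e⁻¹, f}` when `f` is multiplied by an element of the image of `δ`. -/
theorem tprime_pl_inv_dl_inv_mul (e f : E) (l : L) :
    M.tprime e (M.pl e⁻¹ ((M.dl l)⁻¹ * f)) =
      l⁻¹ * M.tprime e (M.pl e⁻¹ f) * M.tprime e (M.actL (M.de e)⁻¹ l) := by
  rw [pl_mul_right, pl_dl_inv_right, map_inv (M.actE _), ← M.dl_equiv, ← map_inv M.dl,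
    tprime_dl, map_inv M.de]
  simp only [tprime_mul_right, tprime_inv, tprime_tprime_inv]
  group

end TwoCrossedModule

/-- The 2-functoriality identity: for every `X ∈ G`, `e, f ∈ E` and `k, l ∈ L`,
`(e ▷′ {e⁻¹, X ▷ f}⁻¹) · ((X ▷ f) ▷′ k) · (X ▷ l)
  = (e ▷′ ((∂(e)⁻¹ X) ▷ l)) · (e ▷′ {e⁻¹ δ(k), X ▷ (δ(l)⁻¹ f)}⁻¹) · k`. -/
theorem two_functoriality {L E G : Type*} [Group L] [Group E] [Group G]
    (M : TwoCrossedModule L E G) :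
    ∀ (X : G) (e f : E) (k l : L),
      M.tprime e (M.pl e⁻¹ (M.actE X f))⁻¹ * M.tprime (M.actE X f) k *
          M.actL X l =
        M.tprime e (M.actL ((M.de e)⁻¹ * X) l) *
          M.tprime e (M.pl (e⁻¹ * M.dl k) (M.actE X ((M.dl l)⁻¹ * f)))⁻¹ * k := by
  intro X e f k l
  rw [map_mul (M.actE X), map_inv (M.actE X), ← M.dl_equiv, map_mul M.actL, MulAut.mul_apply]
  simp only [M.tprime_inv, M.tprime_pl_inv_mul_dl, M.tprime_mul_left, ← map_inv M.dl,
    M.tprime_dl]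
  simp only [map_inv M.dl, M.tprime_pl_inv_dl_inv_mul]
  group
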